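/- (Radon inversion in odd dimensions for ℝ³) For f a Schwartz function on ℝ³, f(x) = −(1/(8π²)) Δ_x ∫_{S²} f̂(u, ⟨u,x⟩) du, where f̂ is the hyperplane (plane) Radon transform and du is surface measure on the unit sphere. -/

import Mathlib

open MeasureTheory Real
open scoped RealInnerProductSpace

/-- The plane Radon transform in `ℝ³`: `f̂(u,s) = ∫_{⟪y,u⟫=s} f dσ`. -/
noncomputable def radonTransform (f : EuclideanSpace ℝ (Fin 3) → ℂ)
    (u : EuclideanSpace ℝ (Fin 3)) (s : ℝ) : ℂ :=
  ∫ v : ((ℝ ∙ u)ᗮ : Submodule ℝ (EuclideanSpace ℝ (Fin 3))), f (s • u + (v : EuclideanSpace ℝ (Fin 3)))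

/-- The Euclidean Laplacian `Δ = ∑ ∂²/∂x_j²` on `ℝ³`. -/
noncomputable def laplacian (f : EuclideanSpace ℝ (Fin 3) → ℂ)
    (x : EuclideanSpace ℝ (Fin 3)) : ℂ :=
  ∑ i : Fin 3, iteratedDeriv 2 (fun t : ℝ => f (x + t • EuclideanSpace.single i (1 : ℝ))) 0

open scoped FourierTransform

section PolarCoordinates

variable {V F : Type*} [NormedAddCommGroup V] [NormedSpace ℝ V] [FiniteDimensional ℝ V]
  [Nontrivial V] [MeasurableSpace V] [BorelSpace V] [NormedAddCommGroup F] [NormedSpace ℝ F]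

/-- Integration in polar coordinates. -/
theorem integral_eq_integral_toSphere_integral_Ioi (μ : Measure V) [μ.IsAddHaarMeasure]
    {g : V → F} (hg : Integrable g μ) :
    ∫ x, g x ∂μ = ∫ u : Metric.sphere (0 : V) 1, ∫ r in Set.Ioi (0 : ℝ),
      r ^ (Module.finrank ℝ V - 1) • g (r • (u : V)) ∂volume ∂μ.toSphere := by
  have hmp := μ.measurePreserving_homeomorphUnitSphereProd
  have hemb := (homeomorphUnitSphereProd V).measurableEmbedding
  have hcomp : ∀ x : ({0}ᶜ : Set V), g x =
      g (((homeomorphUnitSphereProd V x).2 : ℝ) • ((homeomorphUnitSphereProd V x).1 : V)) := by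
    rintro ⟨x, hx⟩
    have hx0 : ‖x‖ ≠ 0 := by simpa using hx
    simp [smul_smul, hx0]
  have hint : Integrable (fun p : Metric.sphere (0 : V) 1 × Set.Ioi (0 : ℝ) =>
      g ((p.2 : ℝ) • (p.1 : V)))
      (μ.toSphere.prod (Measure.volumeIoiPow (Module.finrank ℝ V - 1))) := by
    rw [← hmp.integrable_comp_emb hemb]
    refine Integrable.congr (f := fun x : ({0}ᶜ : Set V) => g x) ?_ (.of_forall hcomp)
    have := (MeasurableEmbedding.subtype_coe
      (measurableSet_singleton (0 : V)).compl).integrableOn_range_iff_comap (f := g) (μ := μ)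
    rw [Subtype.range_coe] at this
    exact this.1 hg.integrableOn
  calc ∫ x, g x ∂μ
      = ∫ x : ({0}ᶜ : Set V), g x ∂(μ.comap (↑)) := by
        rw [integral_subtype_comap (measurableSet_singleton _).compl g,
          restrict_compl_singleton]
    _ = ∫ p, g ((p.2 : ℝ) • (p.1 : V))
          ∂μ.toSphere.prod (Measure.volumeIoiPow (Module.finrank ℝ V - 1)) := by
        rw [← hmp.integral_comp hemb]
        exact integral_congr_ae (.of_forall hcomp)
    _ = ∫ u, ∫ r, g ((r : ℝ) • (u : V))
          ∂Measure.volumeIoiPow (Module.finrank ℝ V - 1) ∂μ.toSphere := integral_prod _ hint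
    _ = _ := by
        refine integral_congr_ae (.of_forall fun u => ?_)
        simp only [Measure.volumeIoiPow, ENNReal.ofReal]
        rw [integral_withDensity_eq_integral_smul
            (measurable_subtype_coe.pow_const _).real_toNNReal,
          integral_subtype_comap measurableSet_Ioi fun a : ℝ =>
            Real.toNNReal (a ^ (Module.finrank ℝ V - 1)) • g (a • (u : V))]
        refine setIntegral_congr_fun measurableSet_Ioi fun r hr => ?_
        rw [NNReal.smul_def, Real.coe_toNNReal _ (pow_nonneg hr.out.le _)]

end PolarCoordinates

section OscillatoryIntegral

variable {α : Type*} [MeasurableSpace α] {μ : Measure α}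

theorem hasDerivAt_integral_mul_cexp {h : α → ℂ} {k : α → ℝ} (hk : AEStronglyMeasurable k μ)
    (hh : Integrable h μ) (hkh : Integrable (fun a => (k a : ℂ) * h a) μ) (t : ℝ) :
    HasDerivAt (fun t : ℝ => ∫ a, h a * Complex.exp (k a * t * Complex.I) ∂μ)
      (∫ a, (Complex.I * (k a * h a)) * Complex.exp (k a * t * Complex.I) ∂μ) t := by
  have hkc : AEStronglyMeasurable (fun a => (k a : ℂ)) μ :=
    Complex.continuous_ofReal.comp_aestronglyMeasurable hk
  have hexp : ∀ t : ℝ, AEStronglyMeasurable (fun a => Complex.exp (k a * t * Complex.I)) μ :=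
    fun t => Complex.continuous_exp.comp_aestronglyMeasurable
      ((hkc.mul aestronglyMeasurable_const).mul aestronglyMeasurable_const)
  have hnorm : ∀ (a : α) (t : ℝ), ‖Complex.exp (k a * t * Complex.I)‖ = 1 := fun a t => by
    exact_mod_cast Complex.norm_exp_ofReal_mul_I (k a * t)
  refine (hasDerivAt_integral_of_dominated_loc_of_deriv_le (s := Set.univ) Filter.univ_mem
    (F' := fun t a => (Complex.I * (k a * h a)) * Complex.exp (k a * t * Complex.I))
    (bound := fun a => ‖(k a : ℂ) * h a‖)
    (.of_forall fun t => hh.1.mul (hexp t)) ?_ ((hkh.1.const_mul _).mul (hexp t)) ?_ hkh.norm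
    ?_).2
  · exact hh.mono (hh.1.mul (hexp t)) (.of_forall fun a => by simp [hnorm])
  · exact .of_forall fun a t _ => by simp [hnorm]
  · refine .of_forall fun a t _ => ?_
    have h1 : HasDerivAt (fun t : ℝ => (k a * t * Complex.I : ℂ)) (k a * 1 * Complex.I) t :=
      ((Complex.ofRealCLM.hasDerivAt (x := t)).const_mul _).mul_const _
    refine (h1.cexp.const_mul (h a)).congr_deriv ?_
    ring

theorem iteratedDeriv_two_integral_mul_cexp {h : α → ℂ} {k : α → ℝ}
    (hk : AEStronglyMeasurable k μ) (hh : Integrable h μ)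
    (hkh : Integrable (fun a => (k a : ℂ) * h a) μ)
    (hkkh : Integrable (fun a => (k a : ℂ) ^ 2 * h a) μ) :
    iteratedDeriv 2 (fun t : ℝ => ∫ a, h a * Complex.exp (k a * t * Complex.I) ∂μ) 0 =
      -∫ a, (k a : ℂ) ^ 2 * h a ∂μ := by
  rw [iteratedDeriv_succ, iteratedDeriv_one,
    funext fun t => (hasDerivAt_integral_mul_cexp hk hh hkh t).deriv,
    (hasDerivAt_integral_mul_cexp hk (hkh.const_mul Complex.I) ?_ 0).deriv, ← integral_neg]
  · refine integral_congr_ae (.of_forall fun a => ?_)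
    simp only [Complex.ofReal_zero, mul_zero, zero_mul, Complex.exp_zero, mul_one]
    linear_combination (k a : ℂ) ^ 2 * h a * Complex.I_sq
  · exact (hkkh.const_mul Complex.I).congr (.of_forall fun a => by simp only; ring)

end OscillatoryIntegral

section Schwartz

variable {V : Type*} [NormedAddCommGroup V] [InnerProductSpace ℝ V]

theorem SchwartzMap.exists_norm_le_one_add_norm_rpow (f : SchwartzMap V ℂ) (n : ℕ) :
    ∃ C : ℝ, ∀ x, ‖f x‖ ≤ C * (1 + ‖x‖) ^ (-(n : ℝ)) := by
  refine ⟨2 ^ n * (Finset.Iic (n, 0)).sup (fun m => SchwartzMap.seminorm ℝ m.1 m.2) f,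
    fun x => ?_⟩
  have h := SchwartzMap.one_add_le_sup_seminorm_apply (𝕜 := ℝ) (m := (n, 0)) le_rfl le_rfl f x
  rw [norm_iteratedFDeriv_zero] at h
  rw [Real.rpow_neg (by positivity), Real.rpow_natCast, ← div_eq_mul_inv,
    le_div_iff₀ (by positivity), mul_comm]
  exact h

variable [FiniteDimensional ℝ V] [MeasurableSpace V] [BorelSpace V]

/-- The decomposition of `V` as the line through a unit vector `u` times its orthogonal
complement. -/
noncomputable def lineProdOrthogonal (u : V) (hu : ‖u‖ = 1) :
    (ℝ × ((ℝ ∙ u)ᗮ : Submodule ℝ V)) ≃ᵐ V :=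
  ((LinearIsometryEquiv.toSpanUnitSingleton u hu).toHomeomorph.toMeasurableEquiv.prodCongr
    (.refl _)).trans ((ℝ ∙ u).measurableEquivProd (0 : V)).symm

theorem lineProdOrthogonal_apply (u : V) (hu : ‖u‖ = 1)
    (p : ℝ × ((ℝ ∙ u)ᗮ : Submodule ℝ V)) :
    lineProdOrthogonal u hu p = p.1 • u + p.2 := by
  simp [lineProdOrthogonal, MeasurableEquiv.prodCongr]

theorem measurePreserving_lineProdOrthogonal (u : V) (hu : ‖u‖ = 1) :
    MeasurePreserving (lineProdOrthogonal u hu) := by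
  have h := (ℝ ∙ u).measurePreserving_measurableEquivProd (0 : V)
  rw [InnerProductSpace.euclideanHausdorffMeasure_eq_volume] at h
  exact ((LinearIsometryEquiv.toSpanUnitSingleton u hu).measurePreserving.prod
    (MeasurePreserving.id volume)).trans h.symm

end Schwartz

local notation "E3" => EuclideanSpace ℝ (Fin 3)

theorem continuous_radonTransform (f : SchwartzMap E3 ℂ) (u : E3) :
    Continuous (radonTransform f u) := by
  obtain ⟨C, hC⟩ := f.exists_norm_le_one_add_norm_rpow 4
  have hC0 : 0 ≤ C := by simpa using (norm_nonneg _).trans (hC 0)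
  refine continuous_of_dominated
    (bound := fun v : ((ℝ ∙ u)ᗮ : Submodule ℝ E3) => C * (1 + ‖v‖) ^ (-((4 : ℕ) : ℝ)))
    (fun s => (f.continuous.comp (by fun_prop)).aestronglyMeasurable)
    (fun s => .of_forall fun v => (hC _).trans ?_)
    ((integrable_one_add_norm ?_).const_mul C)
    (.of_forall fun v => f.continuous.comp (by fun_prop))
  · have hv : ‖v‖ ≤ ‖s • u + (v : E3)‖ := by
      have h0 : ⟪s • u, (v : E3)⟫ = 0 := by
        rw [inner_smul_left, Submodule.mem_orthogonal_singleton_iff_inner_right.1 v.2, mul_zero]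
      have := norm_add_sq_eq_norm_sq_add_norm_sq_of_inner_eq_zero _ _ h0
      rw [Submodule.coe_norm]
      nlinarith [norm_nonneg (s • u), norm_nonneg (v : E3), norm_nonneg (s • u + (v : E3))]
    gcongr C * ?_
    exact Real.rpow_le_rpow_of_nonpos (by positivity) (by linarith) (by norm_num)
  · have := ((ℝ ∙ u)ᗮ : Submodule ℝ E3).finrank_le
    rw [finrank_euclideanSpace_fin] at this
    exact_mod_cast Nat.lt_succ_of_le this

theorem integrable_comp_lineProdOrthogonal (f : SchwartzMap E3 ℂ) {u : E3} (hu : ‖u‖ = 1) :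
    Integrable (fun p : ℝ × ((ℝ ∙ u)ᗮ : Submodule ℝ E3) => f (p.1 • u + p.2)) := by
  simpa only [Function.comp_def, lineProdOrthogonal_apply] using
    ((measurePreserving_lineProdOrthogonal u hu).integrable_comp_emb
      (lineProdOrthogonal u hu).measurableEmbedding).2 f.integrable

theorem integrable_radonTransform (f : SchwartzMap E3 ℂ) {u : E3} (hu : ‖u‖ = 1) :
    Integrable (radonTransform f u) :=
  (integrable_comp_lineProdOrthogonal f hu).integral_prod_left

/-- The Fourier slice theorem. -/
theorem fourier_radonTransform (f : SchwartzMap E3 ℂ) {u : E3} (hu : ‖u‖ = 1) (r : ℝ) :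
    𝓕 (radonTransform f u) r = 𝓕 (f : E3 → ℂ) (r • u) := by
  have hinner : ∀ (s : ℝ) (v : ((ℝ ∙ u)ᗮ : Submodule ℝ E3)),
      ⟪s • u + (v : E3), r • u⟫ = s * r := fun s v => by
    rw [inner_add_left, inner_smul_left, inner_smul_right, inner_smul_right,
      real_inner_self_eq_norm_sq, hu, Submodule.mem_orthogonal_singleton_iff_inner_left.1 v.2]
    simp
  rw [Real.fourier_eq, Real.fourier_eq, ← (measurePreserving_lineProdOrthogonal u hu).integral_comp
    (lineProdOrthogonal u hu).measurableEmbedding]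
  simp only [lineProdOrthogonal_apply, hinner]
  rw [Measure.volume_eq_prod, integral_prod]
  · refine integral_congr_ae (.of_forall fun s => ?_)
    simp only [radonTransform, Circle.smul_def, integral_smul]
    simp [mul_comm]
  · have h := integrable_comp_lineProdOrthogonal f hu
    refine h.mono (AEStronglyMeasurable.smul ?_ h.1) (.of_forall fun p => by simp)
    exact Continuous.aestronglyMeasurable (by fun_prop)

theorem exists_norm_pow_mul_comp_smul_le (g : SchwartzMap E3 ℂ) (n : ℕ) :
    ∃ C : ℝ, ∀ (u : E3) (r : ℝ), ‖u‖ = 1 →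
      ‖(r : ℂ) ^ n * g (r • u)‖ ≤ C * (1 + ‖r‖) ^ (-(2 : ℝ)) := by
  obtain ⟨C, hC⟩ := g.exists_norm_le_one_add_norm_rpow (n + 2)
  refine ⟨C, fun u r hu => ?_⟩
  have h := hC (r • u)
  have hC0 : 0 ≤ C := by simpa using (norm_nonneg _).trans (hC 0)
  rw [norm_smul, hu, mul_one] at h
  rw [norm_mul, norm_pow, Complex.norm_real]
  calc ‖r‖ ^ n * ‖g (r • u)‖
      ≤ (1 + ‖r‖) ^ n * (C * (1 + ‖r‖) ^ (-((n + 2 : ℕ) : ℝ))) := by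
        gcongr
        linarith
    _ = C * (1 + ‖r‖) ^ (-(2 : ℝ)) := by
        rw [← Real.rpow_natCast, mul_left_comm, ← Real.rpow_add (by positivity)]
        push_cast
        ring_nf

theorem integrable_pow_mul_comp_smul (g : SchwartzMap E3 ℂ) {u : E3} (hu : ‖u‖ = 1) (n : ℕ) :
    Integrable (fun r : ℝ => (r : ℂ) ^ n * g (r • u)) := by
  obtain ⟨C, hC⟩ := exists_norm_pow_mul_comp_smul_le g n
  refine ((integrable_one_add_norm (by simp)).const_mul C).mono'
    (Continuous.aestronglyMeasurable ?_) (.of_forall fun r => hC u r hu)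
  have := g.continuous
  fun_prop

theorem integrable_sphere_prod_pow_mul_comp_smul (g : SchwartzMap E3 ℂ) (n : ℕ) :
    Integrable (fun p : Metric.sphere (0 : E3) 1 × ℝ => (p.2 : ℂ) ^ n * g (p.2 • (p.1 : E3)))
      ((volume : Measure E3).toSphere.prod volume) := by
  obtain ⟨C, hC⟩ := exists_norm_pow_mul_comp_smul_le g n
  have hb : Integrable (fun r : ℝ => C * (1 + ‖r‖) ^ (-(2 : ℝ))) :=
    (integrable_one_add_norm (by simp)).const_mul C
  refine (hb.comp_snd (volume : Measure E3).toSphere).mono'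
    (Continuous.aestronglyMeasurable ?_) (.of_forall fun p => hC p.1 p.2 (by simp))
  have := g.continuous
  fun_prop

/-- The Radon transform in a fixed direction, recovered from the Fourier slice theorem. -/
theorem radonTransform_eq_integral_fourier (f : SchwartzMap E3 ℂ) {u : E3} (hu : ‖u‖ = 1)
    (s : ℝ) :
    radonTransform f u s =
      ∫ r : ℝ, 𝓕 f (r • u) * Complex.exp ((2 * π * r * s : ℝ) * Complex.I) := by
  have h𝓕 : 𝓕 (radonTransform f u) = fun r : ℝ => 𝓕 f (r • u) := by
    ext r
    rw [fourier_radonTransform f hu, SchwartzMap.fourier_coe]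
  have hint : Integrable (𝓕 (radonTransform f u)) := by
    rw [h𝓕]
    simpa using integrable_pow_mul_comp_smul (𝓕 f) hu 0
  rw [← (integrable_radonTransform f hu).fourierInv_fourier_eq hint
    (continuous_radonTransform f u).continuousAt, Real.fourierInv_eq', h𝓕]
  refine integral_congr_ae (.of_forall fun r => ?_)
  simp only [smul_eq_mul, RCLike.inner_apply, conj_trivial]
  rw [mul_comm]
  push_cast
  ring_nf

/-- Integration in polar coordinates on `ℝ³`, with the radius running over the whole real line so
that every point is counted twice. -/
theorem integral_toSphere_integral_sq_mul {g : E3 → ℂ} (hg : Integrable g)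
    (hgu : ∀ u : E3, ‖u‖ = 1 → Integrable fun r : ℝ => (r : ℂ) ^ 2 * g (r • u)) :
    ∫ u : Metric.sphere (0 : E3) 1, ∫ r : ℝ, (r : ℂ) ^ 2 * g (r • (u : E3))
      ∂volume ∂(volume : Measure E3).toSphere = 2 * ∫ x, g x := by
  have h := integral_eq_integral_toSphere_integral_Ioi volume (hg.add hg.comp_neg)
  simp only [Pi.add_apply] at h
  rw [integral_add hg hg.comp_neg, integral_neg_eq_self, ← two_mul] at h
  rw [h]
  refine integral_congr_ae (.of_forall fun u => ?_)
  have hu := hgu u (by simp)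
  simp only [finrank_euclideanSpace_fin, Nat.add_one_sub_one]
  rw [← intervalIntegral.integral_Iic_add_Ioi (b := 0) hu.integrableOn hu.integrableOn,
    ← neg_zero (G := ℝ), ← integral_comp_neg_Ioi, neg_zero,
    ← integral_add hu.comp_neg.integrableOn hu.integrableOn]
  refine integral_congr_ae (.of_forall fun r => ?_)
  simp only [Complex.real_smul, neg_smul]
  push_cast
  ring

theorem integral_radonTransform_eq (f : SchwartzMap E3 ℂ) (y : E3) :
    ∫ u : Metric.sphere (0 : E3) 1, radonTransform f u ⟪(u : E3), y⟫
        ∂(volume : Measure E3).toSphere =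
      ∫ p : Metric.sphere (0 : E3) 1 × ℝ, 𝓕 f (p.2 • (p.1 : E3)) *
          Complex.exp ((2 * π * p.2 * ⟪(p.1 : E3), y⟫ : ℝ) * Complex.I)
        ∂(volume : Measure E3).toSphere.prod volume := by
  rw [integral_prod]
  · exact integral_congr_ae (.of_forall fun u =>
      radonTransform_eq_integral_fourier f (by simp) _)
  · have h := integrable_sphere_prod_pow_mul_comp_smul (𝓕 f) 0
    simp only [pow_zero, one_mul] at h
    refine h.mono (h.1.mul (Continuous.aestronglyMeasurable (by fun_prop)))
      (.of_forall fun p => ?_)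
    rw [norm_mul, Complex.norm_exp_ofReal_mul_I, mul_one]

/-- **Radon inversion in `ℝ³`** (John's formula for `n = 3`):
`f(x) = −(1/(8π²)) Δ_x ∫_{S²} f̂(u, ⟪u,x⟫) du`, with `du` the surface measure on `S²`. -/
theorem radon_inversion_R3 (f : SchwartzMap (EuclideanSpace ℝ (Fin 3)) ℂ)
    (x : EuclideanSpace ℝ (Fin 3)) :
    (f x : ℂ) = -(1 / (8 * (π : ℂ) ^ 2)) *
      laplacian (fun y => ∫ u : Metric.sphere (0 : EuclideanSpace ℝ (Fin 3)) 1,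
          radonTransform (fun z => f z) (u : EuclideanSpace ℝ (Fin 3))
            (⟪(u : EuclideanSpace ℝ (Fin 3)), y⟫ : ℝ)
          ∂((volume : Measure (EuclideanSpace ℝ (Fin 3))).toSphere)) x := by
  let σ : Measure (Metric.sphere (0 : E3) 1 × ℝ) := (volume : Measure E3).toSphere.prod volume
  let e : E3 → ℂ := fun ξ => Complex.exp ((2 * π * ⟪ξ, x⟫ : ℝ) * Complex.I)
  let h : Metric.sphere (0 : E3) 1 × ℝ → ℂ := fun p =>
    𝓕 f (p.2 • (p.1 : E3)) * e (p.2 • (p.1 : E3))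
  let k : Fin 3 → Metric.sphere (0 : E3) 1 × ℝ → ℝ := fun i p => 2 * π * p.2 * (p.1 : E3) i
  have he : Continuous e := by fun_prop
  have he1 : ∀ ξ, ‖e ξ‖ = 1 := fun ξ => Complex.norm_exp_ofReal_mul_I _
  have hk : ∀ i, Continuous (k i) := fun i => by fun_prop
  have hcoord : ∀ i (p : Metric.sphere (0 : E3) 1 × ℝ), |(p.1 : E3) i| ≤ 1 := fun i p => by
    simpa using PiLp.norm_apply_le (p.1 : E3) i
  have hh : Continuous h := by
    have := (𝓕 f).continuous
    fun_prop
  have hint : ∀ i n, Integrable (fun p => (k i p : ℂ) ^ n * h p) σ := fun i n => by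
    refine ((integrable_sphere_prod_pow_mul_comp_smul (𝓕 f) n).const_mul
      ((2 * π : ℂ) ^ n)).mono (Continuous.aestronglyMeasurable (by fun_prop))
      (.of_forall fun p => ?_)
    have h1 : |(p.1 : E3) i| ^ n ≤ 1 := pow_le_one₀ (abs_nonneg _) (hcoord i p)
    simp only [h, k, norm_mul, norm_pow, he1, Complex.norm_real, Real.norm_eq_abs,
      mul_pow, Complex.norm_ofNat, abs_two, mul_one]
    have : 0 ≤ 2 ^ n * |π| ^ n * |p.2| ^ n * ‖𝓕 f (p.2 • (p.1 : E3))‖ := by positivity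
    nlinarith
  have hline : ∀ i (t : ℝ), (∫ u : Metric.sphere (0 : E3) 1,
      radonTransform (fun z => f z) u ⟪(u : E3), x + t • EuclideanSpace.single i (1 : ℝ)⟫
        ∂(volume : Measure E3).toSphere) =
      ∫ p, h p * Complex.exp (k i p * t * Complex.I) ∂σ := fun i t => by
    refine (integral_radonTransform_eq f _).trans (integral_congr_ae (.of_forall fun p => ?_))
    simp only [h, e, k, mul_assoc]
    rw [← Complex.exp_add]
    congr 2
    rw [inner_add_right, inner_smul_right, inner_smul_left, EuclideanSpace.inner_single_right]
    simp
    ring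
  have hsum : ∀ p, ∑ i, (k i p : ℂ) ^ 2 * h p = 4 * π ^ 2 * ((p.2 : ℂ) ^ 2 * h p) := fun p => by
    have h1 : ∑ i, ((p.1 : E3) i) ^ 2 = 1 := by
      rw [← EuclideanSpace.real_norm_sq_eq]
      simp
    have h2 : ∑ i, (((p.1 : E3) i : ℝ) : ℂ) ^ 2 = 1 := by exact_mod_cast h1
    simp only [k, Fin.sum_univ_three] at h2 ⊢
    push_cast
    linear_combination 4 * π ^ 2 * p.2 ^ 2 * h p * h2
  have hFe : Integrable fun ξ => 𝓕 f ξ * e ξ :=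
    (𝓕 f).integrable.mono ((𝓕 f).continuous.mul he).aestronglyMeasurable
      (.of_forall fun ξ => by simp [he1])
  have hinv : ∫ ξ, 𝓕 f ξ * e ξ = f x := by
    have h1 : 𝓕⁻ (𝓕 f) x = f x := by simp
    rw [← h1, SchwartzMap.fourierInv_coe, Real.fourierInv_eq']
    simp only [e, smul_eq_mul, mul_comm]
  have hpolar : ∫ p, (p.2 : ℂ) ^ 2 * h p ∂σ = 2 * f x := by
    rw [← hinv, ← integral_toSphere_integral_sq_mul hFe, integral_prod]
    · refine ((integrable_sphere_prod_pow_mul_comp_smul (𝓕 f) 2)).mono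
        (Continuous.aestronglyMeasurable (by fun_prop)) (.of_forall fun p => ?_)
      simp [h, he1]
    · intro u hu
      refine (integrable_pow_mul_comp_smul (𝓕 f) hu 2).mono
        (Continuous.aestronglyMeasurable ?_) (.of_forall fun r => by simp [he1])
      have := (𝓕 f).continuous
      fun_prop
  have hlap : ∀ i, iteratedDeriv 2 (fun t : ℝ => ∫ u : Metric.sphere (0 : E3) 1,
      radonTransform (fun z => f z) u ⟪(u : E3), x + t • EuclideanSpace.single i (1 : ℝ)⟫
        ∂(volume : Measure E3).toSphere) 0 = -∫ p, (k i p : ℂ) ^ 2 * h p ∂σ := fun i => by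
    rw [funext (hline i)]
    exact iteratedDeriv_two_integral_mul_cexp (hk i).aestronglyMeasurable
      (by simpa using hint i 0) (by simpa using hint i 1) (hint i 2)
  have hπ : (π : ℂ) ≠ 0 := by exact_mod_cast Real.pi_ne_zero
  rw [laplacian, Finset.sum_congr rfl fun i _ => hlap i, Finset.sum_neg_distrib,
    ← integral_finsetSum _ fun i _ => hint i 2, integral_congr_ae (.of_forall hsum),
    integral_const_mul, hpolar]
  field_simp
  ring
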